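/- Let V be a unital algebra over a commutative ring R (not necessarily associative or commutative), let Q : V → V be an R-linear map with Q(ab) = Q(a)·b + a·Q(b) for all a,b ∈ V and Q∘Q = 0, and let Δ : V → V be an R-linear map with Q∘Δ + Δ∘Q = 0. If a₁,…,a_r ∈ Ker(Q) and a_j ∈ Im(Q) for at least one index j, then Φ^r_Δ(a₁,…,a_r) ∈ Im(Q). Consequently the brackets Φ^r_Δ descend to well-defined r-linear operations on the cohomology H(V,Q) = Ker(Q)/Im(Q). -/

import Mathlib

/-- The recursively defined operators `Φʳ_Δ`, implemented on the reversed argument list. -/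
def PhiAux {V : Type*} [One V] [Mul V] [Sub V] (Δ : V → V) : List V → V
  | [] => Δ 1
  | [a] => Δ a - Δ 1 * a
  | b :: a :: rest =>
      PhiAux Δ ((a * b) :: rest) - PhiAux Δ (a :: rest) * b - a * PhiAux Δ (b :: rest)
termination_by l => l.length

/-- `Phi Δ [a₁, …, a_r] = Φʳ_Δ(a₁,…,a_r)`. -/
def Phi {V : Type*} [One V] [Mul V] [Sub V] (Δ : V → V) (l : List V) : V :=
  PhiAux Δ l.reverse

section

variable {R V : Type*} [CommRing R] [NonAssocRing V] [Module R V] {Q Δ : V →ₗ[R] V}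

theorem mul_mem_ker_of_derivation (hQder : ∀ a b : V, Q (a * b) = Q a * b + a * Q b)
    {a b : V} (ha : Q a = 0) (hb : Q b = 0) : Q (a * b) = 0 := by
  simp [hQder, ha, hb]

theorem mul_mem_range_of_mem_range_of_mem_ker
    (hQder : ∀ a b : V, Q (a * b) = Q a * b + a * Q b)
    {a b : V} (ha : a ∈ LinearMap.range Q) (hb : Q b = 0) : a * b ∈ LinearMap.range Q := by
  obtain ⟨x, rfl⟩ := ha
  exact ⟨x * b, by simp [hQder, hb]⟩

theorem mul_mem_range_of_mem_ker_of_mem_range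
    (hQder : ∀ a b : V, Q (a * b) = Q a * b + a * Q b)
    {a b : V} (ha : Q a = 0) (hb : b ∈ LinearMap.range Q) : a * b ∈ LinearMap.range Q := by
  obtain ⟨x, rfl⟩ := hb
  exact ⟨a * x, by simp [hQder, ha]⟩

theorem map_one_eq_zero_of_derivation (hQder : ∀ a b : V, Q (a * b) = Q a * b + a * Q b) :
    Q 1 = 0 := by
  simpa using hQder 1 1

theorem map_apply_eq_zero_of_anticomm (hanti : ∀ x, Q (Δ x) = -Δ (Q x)) {a : V}
    (ha : Q a = 0) : Q (Δ a) = 0 := by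
  simp [hanti, ha]

/-- `PhiAux Δ` preserves the kernel of `Q`. -/
theorem map_phiAux_eq_zero (hQder : ∀ a b : V, Q (a * b) = Q a * b + a * Q b)
    (hanti : ∀ x, Q (Δ x) = -Δ (Q x)) (l : List V) (hl : ∀ x ∈ l, Q x = 0) :
    Q (PhiAux Δ l) = 0 := by
  have h1 := map_apply_eq_zero_of_anticomm hanti (map_one_eq_zero_of_derivation hQder)
  fun_induction PhiAux (Δ : V → V) l with
  | case1 => exact h1
  | case2 a =>
    have ha : Q a = 0 := hl a (by simp)
    rw [map_sub, map_apply_eq_zero_of_anticomm hanti ha,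
      mul_mem_ker_of_derivation hQder h1 ha, sub_zero]
  | case3 b a rest ih₁ ih₂ ih₃ =>
    simp only [List.forall_mem_cons] at hl ih₁ ih₂ ih₃
    obtain ⟨hb, ha, hrest⟩ := hl
    rw [map_sub, map_sub, ih₁ ⟨mul_mem_ker_of_derivation hQder ha hb, hrest⟩,
      mul_mem_ker_of_derivation hQder (ih₂ ⟨ha, hrest⟩) hb,
      mul_mem_ker_of_derivation hQder ha (ih₃ ⟨hb, hrest⟩), sub_zero, sub_zero]

/-- `PhiAux Δ` of elements of the kernel of `Q`, one of which is in the range of `Q`,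
is in the range of `Q`. -/
theorem phiAux_mem_range (hQder : ∀ a b : V, Q (a * b) = Q a * b + a * Q b)
    (hanti : ∀ x, Q (Δ x) = -Δ (Q x)) (l : List V) (hl : ∀ x ∈ l, Q x = 0)
    (hr : ∃ x ∈ l, x ∈ LinearMap.range Q) : PhiAux Δ l ∈ LinearMap.range Q := by
  have h1 := map_apply_eq_zero_of_anticomm hanti (map_one_eq_zero_of_derivation hQder)
  fun_induction PhiAux (Δ : V → V) l with
  | case1 => simp at hr
  | case2 a =>
    have ha : a ∈ LinearMap.range Q := by simpa using hr
    refine sub_mem ?_ (mul_mem_range_of_mem_ker_of_mem_range hQder h1 ha)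
    obtain ⟨x, rfl⟩ := ha
    exact ⟨-Δ x, by simp [hanti]⟩
  | case3 b a rest ih₁ ih₂ ih₃ =>
    have hker := map_phiAux_eq_zero hQder hanti
    have hker₂ := hker (a :: rest)
    have hker₃ := hker (b :: rest)
    simp only [List.forall_mem_cons, List.exists_mem_cons_iff] at hl hr ih₁ ih₂ ih₃ hker₂ hker₃
    obtain ⟨hb, ha, hrest⟩ := hl
    have hab := mul_mem_ker_of_derivation hQder ha hb
    rcases hr with hbr | har | hr
    · exact sub_mem (sub_mem
        (ih₁ ⟨hab, hrest⟩ (.inl (mul_mem_range_of_mem_ker_of_mem_range hQder ha hbr)))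
        (mul_mem_range_of_mem_ker_of_mem_range hQder (hker₂ ⟨ha, hrest⟩) hbr))
        (mul_mem_range_of_mem_ker_of_mem_range hQder ha (ih₃ ⟨hb, hrest⟩ (.inl hbr)))
    · exact sub_mem (sub_mem
        (ih₁ ⟨hab, hrest⟩ (.inl (mul_mem_range_of_mem_range_of_mem_ker hQder har hb)))
        (mul_mem_range_of_mem_range_of_mem_ker hQder (ih₂ ⟨ha, hrest⟩ (.inl har)) hb))
        (mul_mem_range_of_mem_range_of_mem_ker hQder har (hker₃ ⟨hb, hrest⟩))
    · exact sub_mem (sub_mem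
        (ih₁ ⟨hab, hrest⟩ (.inr hr))
        (mul_mem_range_of_mem_range_of_mem_ker hQder (ih₂ ⟨ha, hrest⟩ (.inr hr)) hb))
        (mul_mem_range_of_mem_ker_of_mem_range hQder ha (ih₃ ⟨hb, hrest⟩ (.inr hr)))

end

/-- (Part of the Cohomological Derived Brackets Theorem.) If `Q` is a square-zero
derivation of a unital algebra `V`, `Δ` anticommutes with `Q`, the arguments
`a₁,…,a_r` lie in `Ker(Q)`, and at least one of them lies in `Im(Q)`, then
`Φʳ_Δ(a₁,…,a_r) ∈ Im(Q)`; consequently the brackets `Φʳ_Δ` descend to the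
cohomology `H(V,Q) = Ker(Q)/Im(Q)`. -/
theorem phi_preserves_im
    (R V : Type*) [CommRing R] [NonAssocRing V] [Module R V]
    (Q Δ : V →ₗ[R] V)
    (hQder : ∀ a b : V, Q (a * b) = Q a * b + a * Q b)
    (hQQ : Q ∘ₗ Q = 0)
    (hanti : Q ∘ₗ Δ + Δ ∘ₗ Q = 0) :
    ∀ (r : ℕ), 1 ≤ r → ∀ a : Fin r → V,
      (∀ i, Q (a i) = 0) → (∃ j, a j ∈ LinearMap.range Q) →
        Phi (⇑Δ) (List.ofFn a) ∈ LinearMap.range Q := by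
  rintro r - a ha ⟨j, hj⟩
  refine phiAux_mem_range hQder (fun x => eq_neg_of_add_eq_zero_left (LinearMap.congr_fun hanti x))
    _ ?_ ⟨a j, by simp, hj⟩
  simpa [List.mem_ofFn] using ha
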